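/- Let Ω = (0,1) with its Borel σ-algebra, let λ be Lebesgue measure on (0,1), and let 𝒫 be the set of all probability measures of the form (1/2)λ + (1/2)∑_{k≥1} α_k δ_{x_k}, where x_k ∈ (0,1), α_k ≥ 0 and ∑_{k≥1} α_k = 1. Then 𝒫 is not pre-Hahn-localizable: there exists no family 𝒬 of probability measures on the Borel σ-algebra together with Borel sets S_Q satisfying Q(S_R) = 1 if Q = R and Q(S_R) = 0 if Q ≠ R for all Q, R ∈ 𝒬, and 𝒬 ⋘ 𝒫 ⋘ sconv(𝒬). -/

import Mathlib

open MeasureTheory Set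
open scoped ENNReal

variable {Ω : Type*}

/-- `Q ⋘ P`: every element of `Q` is absolutely continuous w.r.t. some element of `P`. -/
def Lll [MeasurableSpace Ω] (Q P : Set (Measure Ω)) : Prop :=
  ∀ q ∈ Q, ∃ p ∈ P, q ≪ p

/-- The σ-convex hull of a family of measures. -/
def sconv [MeasurableSpace Ω] (Q : Set (Measure Ω)) : Set (Measure Ω) :=
  {μ | ∃ (f : ℕ → Measure Ω) (l : ℕ → ℝ≥0∞), (∀ k, f k ∈ Q) ∧ (∑' k, l k) = 1 ∧
    μ = Measure.sum fun k => l k • f k}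

/-- `P` is pre-Hahn-localizable with localization `Q` and supports `S`. -/
structure IsPreHahnLoc [MeasurableSpace Ω] (P Q : Set (Measure Ω))
    (S : Measure Ω → Set Ω) : Prop where
  probP : ∀ p ∈ P, IsProbabilityMeasure p
  probQ : ∀ q ∈ Q, IsProbabilityMeasure q
  measS : ∀ q ∈ Q, MeasurableSet (S q)
  self : ∀ q ∈ Q, q (S q) = 1
  other : ∀ q ∈ Q, ∀ r ∈ Q, q ≠ r → q (S r) = 0
  qp : Lll Q P
  ps : Lll P (sconv Q)

/-- Lebesgue measure on the unit interval `(0,1)` (as a subtype of `ℝ`). -/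
noncomputable def lam01 : Measure ↥(Set.Ioo (0:ℝ) 1) :=
  (volume : Measure ℝ).comap Subtype.val

/-- The non-dominated family `{(1/2)·λ + (1/2)·∑_k α_k δ_{x_k}}` on `(0,1)`. -/
noncomputable def halfLebHalfAtomic : Set (Measure ↥(Set.Ioo (0:ℝ) 1)) :=
  {p | ∃ (x : ℕ → ↥(Set.Ioo (0:ℝ) 1)) (a : ℕ → ℝ≥0∞), (∑' k, a k) = 1 ∧
    p = (2⁻¹ : ℝ≥0∞) • lam01 +
      (2⁻¹ : ℝ≥0∞) • Measure.sum fun k => a k • Measure.dirac (x k)}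

theorem lam01_apply (s : Set ↥(Set.Ioo (0:ℝ) 1)) :
    lam01 s = volume (Subtype.val '' s) :=
  (MeasurableEmbedding.subtype_coe measurableSet_Ioo).comap_apply _ s

theorem lam01_countable {s : Set ↥(Set.Ioo (0:ℝ) 1)} (hs : s.Countable) : lam01 s = 0 := by
  rw [lam01_apply]
  exact (hs.image _).measure_zero _

theorem lam01_univ : lam01 univ = 1 := by
  rw [lam01_apply, image_univ, Subtype.range_coe]
  simp

theorem half_lam01_add_dirac_mem (x : ↥(Set.Ioo (0:ℝ) 1)) :
    (2⁻¹ : ℝ≥0∞) • lam01 + (2⁻¹ : ℝ≥0∞) • Measure.dirac x ∈ halfLebHalfAtomic := by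
  refine ⟨fun _ => x, Pi.single 0 1, tsum_pi_single 0 1, ?_⟩
  congr 2
  ext s hs
  rw [Measure.sum_apply _ hs, tsum_eq_single 0]
  · simp
  · intro k hk
    simp [hk]

/-- A finite measure on a space with measurable singletons has countably many atoms. -/
theorem countable_setOf_measure_singleton_ne_zero [MeasurableSpace Ω]
    [MeasurableSingletonClass Ω] (μ : Measure Ω) [IsFiniteMeasure μ] :
    {x | μ {x} ≠ 0}.Countable := by
  have h := Measure.countable_meas_pos_of_disjoint_iUnion (μ := μ)
    (As := fun x : Ω => ({x} : Set Ω)) (fun x => measurableSet_singleton x)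
    (fun x y hxy => by simpa using hxy)
  simpa only [pos_iff_ne_zero] using h

/-- If a countable mixture of measures charges `s`, then so does some component. -/
theorem exists_ne_zero_of_mem_sconv [MeasurableSpace Ω] {Q : Set (Measure Ω)} {μ : Measure Ω}
    (hμ : μ ∈ sconv Q) {s : Set Ω} (hs : MeasurableSet s) (h : μ s ≠ 0) :
    ∃ q ∈ Q, q s ≠ 0 := by
  obtain ⟨f, l, hf, -, rfl⟩ := hμ
  by_contra! hc
  refine h ?_
  simp [Measure.sum_apply _ hs, hc _ (hf _)]

/-- The family of measures `(1/2)λ + (1/2)∑_k α_k δ_{x_k}` on the unit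
interval is not pre-Hahn-localizable. -/
theorem stmt16 :
    ¬ ∃ (Q : Set (Measure ↥(Set.Ioo (0:ℝ) 1)))
        (S : Measure ↥(Set.Ioo (0:ℝ) 1) → Set ↥(Set.Ioo (0:ℝ) 1)),
      IsPreHahnLoc halfLebHalfAtomic Q S := by
  rintro ⟨Q, S, h⟩
  have atom : ∀ x, ∃ q ∈ Q, q {x} ≠ 0 := by
    intro x
    obtain ⟨μ, hμ, hac⟩ := h.ps _ (half_lam01_add_dirac_mem x)
    refine exists_ne_zero_of_mem_sconv hμ (measurableSet_singleton x) fun h0 => ?_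
    simpa using hac h0
  have h0 : (0:ℝ) < 1 / 2 ∧ (1 / 2 : ℝ) < 1 := by norm_num
  obtain ⟨μ, ⟨f, l, hf, -, rfl⟩, hac⟩ := h.ps _ (half_lam01_add_dirac_mem ⟨1 / 2, h0⟩)
  have hU : MeasurableSet (⋃ k, S (f k)) := .iUnion fun k => h.measS _ (hf k)
  have hnull : lam01 (⋃ k, S (f k))ᶜ = 0 := by
    have hsum : (Measure.sum fun k => l k • f k) (⋃ k, S (f k))ᶜ = 0 := by
      rw [Measure.sum_apply _ hU.compl, ENNReal.tsum_eq_zero]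
      intro k
      have := h.probQ _ (hf k)
      have hk : f k (S (f k))ᶜ = 0 :=
        (prob_compl_eq_zero_iff (h.measS _ (hf k))).2 (h.self _ (hf k))
      have hk' : f k (⋃ k, S (f k))ᶜ = 0 :=
        measure_mono_null (compl_subset_compl.2 (subset_iUnion (fun k => S (f k)) k)) hk
      rw [Measure.smul_apply, hk', smul_zero]
    have := hac hsum
    simp only [Measure.add_apply, Measure.smul_apply, smul_eq_mul, add_eq_zero, mul_eq_zero] at this
    simpa using this.1
  have hcount : (⋃ k, S (f k)).Countable := by
    refine Countable.mono (s₂ := ⋃ k, {x | f k {x} ≠ 0}) ?_ (countable_iUnion fun k => ?_)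
    · intro x hx
      obtain ⟨k, hk⟩ := mem_iUnion.1 hx
      obtain ⟨q, hq, hqx⟩ := atom x
      refine mem_iUnion.2 ⟨k, ?_⟩
      by_cases hqk : q = f k
      · exact hqk ▸ hqx
      · exact absurd (measure_mono_null (singleton_subset_iff.2 hk) (h.other q hq _ (hf k) hqk)) hqx
    · have := h.probQ _ (hf k)
      exact countable_setOf_measure_singleton_ne_zero (f k)
  have hzero : lam01 univ = 0 := by
    rw [← union_compl_self (⋃ k, S (f k))]
    exact measure_union_null (lam01_countable hcount) hnull
  simp [lam01_univ] at hzero
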